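/- Let Γ ⊆ ℓ²(ℕ) be an orthosymmetric, convex, compact set, let ε > 0, and let d = D_c(Γ, ε) − 1 ≥ 1. Then there exist ⌊d/2⌋ pairwise orthogonal vectors u₁, …, u_{⌊d/2⌋} ∈ Γ such that ‖u_i‖_{ℓ²} ≥ ε/√d for every 1 ≤ i ≤ ⌊d/2⌋. -/

import Mathlib

open scoped RealInnerProductSpace ENNReal

/-- The real Hilbert space `ℓ²(ℕ)` of square-summable sequences. -/
noncomputable abbrev SeqL2 : Type := lp (fun _ : ℕ => ℝ) 2

/-- A set `Γ ⊆ ℓ²(ℕ)` is orthosymmetric if it is closed under coordinatewise sign flips. -/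
def OrthosymmetricSeq (Γ : Set SeqL2) : Prop :=
  ∀ θ ∈ Γ, ∀ η : SeqL2, (∀ i, η i = θ i ∨ η i = -θ i) → η ∈ Γ

/-- `P` is an orthogonal projection of rank `d`: self-adjoint, idempotent, with
`d`-dimensional range. -/
def IsOrthoProjOfRank {H : Type*} [NormedAddCommGroup H] [InnerProductSpace ℝ H]
    (P : H →ₗ[ℝ] H) (d : ℕ) : Prop :=
  (∀ x y : H, ⟪P x, y⟫ = ⟪x, P y⟫) ∧ (∀ x, P (P x) = P x) ∧
    Module.finrank ℝ (LinearMap.range P) = d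

/-- The Kolmogorov dimension of `Γ ⊆ ℓ²(ℕ)` at scale `ε`: the smallest `d` such that some
orthogonal projection onto a `d`-dimensional subspace approximates every `θ ∈ Γ` within
`ℓ²`-error `ε`. -/
noncomputable def kolDim (Γ : Set SeqL2) (ε : ℝ) : ℕ :=
  sInf {d : ℕ | ∃ P : SeqL2 →ₗ[ℝ] SeqL2, IsOrthoProjOfRank P d ∧ ∀ θ ∈ Γ, ‖θ - P θ‖ ≤ ε}

/-- The coordinate-wise Kolmogorov dimension of `Γ ⊆ ℓ²(ℕ)` at scale `ε`: the smallest `d`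
such that for some set `A` of `d` coordinates, `sup_{θ ∈ Γ} Σ_{i ∉ A} θ_i² ≤ ε²`. -/
noncomputable def kolDimCoord (Γ : Set SeqL2) (ε : ℝ) : ℕ :=
  sInf {d : ℕ | ∃ A : Finset ℕ, A.card = d ∧
    ∀ θ ∈ Γ, (∑' i : {i : ℕ // i ∉ A}, (θ (i : ℕ)) ^ 2) ≤ ε ^ 2}

/-- A finite family of numbers below `c` with sum at least `c` has a subfamily with sum in
`[c, 2c)`. -/
lemma exists_subset_sum_mem_Ico {ι : Type*} [DecidableEq ι] {f : ι → ℝ} {c : ℝ} (hc : 0 < c)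
    (F : Finset ι) (hf : ∀ i ∈ F, f i < c) (hF : c ≤ ∑ i ∈ F, f i) :
    ∃ S ⊆ F, c ≤ ∑ i ∈ S, f i ∧ ∑ i ∈ S, f i < 2 * c := by
  induction F using Finset.induction_on with
  | empty => simp at hF; linarith
  | insert a F ha ih =>
    by_cases h : c ≤ ∑ i ∈ F, f i
    · obtain ⟨S, hS, hS'⟩ := ih (fun i hi => hf i (Finset.mem_insert_of_mem hi)) h
      exact ⟨S, hS.trans (Finset.subset_insert a F), hS'⟩
    · refine ⟨insert a F, subset_rfl, hF, ?_⟩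
      rw [Finset.sum_insert ha]
      linarith [hf a (Finset.mem_insert_self a F)]

/-- A finite family of numbers below `c` with sum at least `2cm` has `m` disjoint subfamilies,
each with sum at least `c`. -/
lemma exists_pairwise_disjoint_le_sum {ι : Type*} [DecidableEq ι] {f : ι → ℝ} {c : ℝ}
    (hc : 0 < c) (m : ℕ) (F : Finset ι) (hf : ∀ i ∈ F, f i < c)
    (hF : 2 * c * m ≤ ∑ i ∈ F, f i) :
    ∃ S : Fin m → Finset ι, (∀ k, S k ⊆ F) ∧ (∀ k l, k ≠ l → Disjoint (S k) (S l)) ∧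
      ∀ k, c ≤ ∑ i ∈ S k, f i := by
  induction m generalizing F with
  | zero => exact ⟨fun _ => ∅, fun k => k.elim0, fun k => k.elim0, fun k => k.elim0⟩
  | succ m ih =>
    push_cast at hF
    have hcm : 0 ≤ c * m := by positivity
    obtain ⟨T, hTF, hT, hT'⟩ := exists_subset_sum_mem_Ico hc F hf (by linarith)
    have hsplit := Finset.sum_sdiff (f := f) hTF
    obtain ⟨S, hSF, hdisj, hS⟩ := ih (F \ T)
      (fun i hi => hf i (Finset.sdiff_subset hi)) (by linarith)
    have hTS : ∀ k, Disjoint T (S k) := fun k =>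
      Finset.disjoint_of_subset_right (hSF k) Finset.disjoint_sdiff
    refine ⟨Fin.cons T S, ?_, ?_, ?_⟩
    · intro k
      cases k using Fin.cases with
      | zero => simpa using hTF
      | succ k => simpa using (hSF k).trans Finset.sdiff_subset
    · intro k l hkl
      cases k using Fin.cases with
      | zero =>
        cases l using Fin.cases with
        | zero => exact absurd rfl hkl
        | succ l => simpa using hTS l
      | succ k =>
        cases l using Fin.cases with
        | zero => simpa using (hTS k).symm
        | succ l => simpa using hdisj k l (fun h => hkl (by rw [h]))
    · intro k
      cases k using Fin.cases with
      | zero => simpa using hT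
      | succ k => simpa using hS k

/-- The restriction of a sequence to a finite set of coordinates. -/
noncomputable def SeqL2.restrict (θ : SeqL2) (S : Finset ℕ) : SeqL2 :=
  ∑ i ∈ S, lp.single 2 i (θ i)

lemma SeqL2.restrict_apply (θ : SeqL2) (S : Finset ℕ) (j : ℕ) :
    SeqL2.restrict θ S j = if j ∈ S then θ j else 0 := by
  rw [SeqL2.restrict, lp.coeFn_sum]
  refine (Finset.sum_apply j S fun i => (lp.single 2 i (θ i) : ℕ → ℝ)).trans ?_
  simp [Pi.single_apply]

lemma SeqL2.inner_restrict (θ η : SeqL2) (S T : Finset ℕ) :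
    ⟪SeqL2.restrict θ S, SeqL2.restrict η T⟫ = ∑ i ∈ S ∩ T, θ i * η i := by
  rw [lp.inner_eq_tsum, tsum_eq_sum (s := S ∩ T)]
  · refine Finset.sum_congr rfl fun i hi => ?_
    rw [Finset.mem_inter] at hi
    simp [SeqL2.restrict_apply, hi.1, hi.2, mul_comm]
  · intro i hi
    rw [Finset.mem_inter, not_and_or] at hi
    rcases hi with hi | hi <;> simp [SeqL2.restrict_apply, hi]

lemma SeqL2.norm_restrict_sq (θ : SeqL2) (S : Finset ℕ) :
    ‖SeqL2.restrict θ S‖ ^ 2 = ∑ i ∈ S, θ i ^ 2 := by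
  rw [← real_inner_self_eq_norm_sq, SeqL2.inner_restrict, Finset.inter_self]
  exact Finset.sum_congr rfl fun i _ => (sq (θ i)).symm

/-- Convex orthosymmetric sets are closed under restriction to finitely many coordinates. -/
lemma OrthosymmetricSeq.restrict_mem {Γ : Set SeqL2} (horth : OrthosymmetricSeq Γ)
    (hconv : Convex ℝ Γ) {θ : SeqL2} (hθ : θ ∈ Γ) (S : Finset ℕ) :
    SeqL2.restrict θ S ∈ Γ := by
  have hη : (2 : ℝ) • SeqL2.restrict θ S - θ ∈ Γ := by
    refine horth θ hθ _ fun i => ?_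
    rw [lp.coeFn_sub, lp.coeFn_smul, Pi.sub_apply, Pi.smul_apply, SeqL2.restrict_apply]
    by_cases hi : i ∈ S
    · left
      simp only [hi, if_true, smul_eq_mul]
      ring
    · right
      simp [hi]
  have h := hconv hθ hη (show (0 : ℝ) ≤ 1 / 2 by norm_num) (show (0 : ℝ) ≤ 1 / 2 by norm_num)
    (by norm_num)
  convert h using 1
  module

/-- Elements of a convex orthosymmetric set carrying mass at least `r²` on pairwise disjoint
finite sets of coordinates yield orthogonal elements of norm at least `r`. -/
lemma OrthosymmetricSeq.exists_orthogonal_of_disjoint {Γ : Set SeqL2}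
    (horth : OrthosymmetricSeq Γ) (hconv : Convex ℝ Γ) {ι : Type*} {r : ℝ}
    (θ : ι → SeqL2) (hθ : ∀ k, θ k ∈ Γ) (S : ι → Finset ℕ)
    (hS : ∀ k l, k ≠ l → Disjoint (S k) (S l)) (hr : ∀ k, r ^ 2 ≤ ∑ i ∈ S k, θ k i ^ 2) :
    ∃ u : ι → SeqL2, (∀ k, u k ∈ Γ) ∧ (∀ k l, k ≠ l → ⟪u k, u l⟫ = 0) ∧ ∀ k, r ≤ ‖u k‖ := by
  refine ⟨fun k => SeqL2.restrict (θ k) (S k), fun k => horth.restrict_mem hconv (hθ k) _,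
    fun k l hkl => ?_, fun k => ?_⟩
  · rw [SeqL2.inner_restrict, Finset.disjoint_iff_inter_eq_empty.mp (hS k l hkl),
      Finset.sum_empty]
  · refine le_of_abs_le (abs_le_of_sq_le_sq ?_ (norm_nonneg _))
    rw [SeqL2.norm_restrict_sq]
    exact hr k

/-- A coordinate set smaller than the coordinate-wise Kolmogorov dimension misses more than `ε²`
of the mass of some element, already on finitely many coordinates. -/
lemma exists_finset_lt_sum_of_card_lt_kolDimCoord {Γ : Set SeqL2} {ε : ℝ} {A : Finset ℕ}
    (hA : A.card < kolDimCoord Γ ε) :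
    ∃ θ ∈ Γ, ∃ F : Finset ℕ, Disjoint F A ∧ ε ^ 2 < ∑ i ∈ F, θ i ^ 2 := by
  have h := Nat.notMem_of_lt_sInf hA
  simp only [Set.mem_ofPred_eq, not_exists, not_and, not_forall, not_le] at h
  obtain ⟨θ, hθ, hlt⟩ := h A rfl
  have hsum : Summable fun i : {i : ℕ // i ∉ A} => θ (i : ℕ) ^ 2 := by
    by_contra hns
    rw [tsum_eq_zero_of_not_summable hns] at hlt
    exact absurd hlt (sq_nonneg ε).not_gt
  obtain ⟨t, ht⟩ := (hsum.hasSum.eventually (lt_mem_nhds hlt)).exists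
  refine ⟨θ, hθ, t.map (Function.Embedding.subtype _), ?_, by simpa using ht⟩
  rw [Finset.disjoint_left]
  intro i hi
  obtain ⟨j, -, rfl⟩ := Finset.mem_map.mp hi
  exact j.2

/-- For an orthosymmetric, convex, compact `Γ ⊆ ℓ²(ℕ)` with `d = D_c(Γ, ε) − 1 ≥ 1`, there
are `⌊d/2⌋` pairwise orthogonal vectors in `Γ`, each of norm at least `ε/√d`. -/
theorem exists_orthogonal_vectors_in_orthosymmetric (Γ : Set SeqL2)
    (horth : OrthosymmetricSeq Γ) (hconv : Convex ℝ Γ) (hcomp : IsCompact Γ)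
    (ε : ℝ) (hε : 0 < ε) (d : ℕ) (hd : d = kolDimCoord Γ ε - 1) (hd1 : 1 ≤ d) :
    ∃ u : Fin (d / 2) → SeqL2,
      (∀ i, u i ∈ Γ) ∧
      (∀ i j, i ≠ j → ⟪u i, u j⟫ = 0) ∧
      (∀ i, ε / Real.sqrt d ≤ ‖u i‖) := by
  have hd0 : (0 : ℝ) < d := by exact_mod_cast hd1
  have hsq : (ε / Real.sqrt d) ^ 2 = ε ^ 2 / d := by rw [div_pow, Real.sq_sqrt hd0.le]
  have hc : 0 < (ε / Real.sqrt d) ^ 2 := by rw [hsq]; positivity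
  by_cases hB : ∃ A : Finset ℕ, A.card = d / 2 ∧
      ∀ i ∈ A, ∃ θ ∈ Γ, (ε / Real.sqrt d) ^ 2 ≤ θ i ^ 2
  · obtain ⟨A, hAcard, hA⟩ := hB
    let e := A.equivFinOfCardEq hAcard
    choose θ hθΓ hθ using fun k => hA (e.symm k) (e.symm k).2
    refine horth.exists_orthogonal_of_disjoint hconv θ hθΓ (fun k => {(e.symm k : ℕ)})
      (fun k l hkl => ?_) (fun k => by simpa using hθ k)
    rw [Finset.disjoint_singleton]
    exact fun h => hkl (e.symm.injective (Subtype.ext h))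
  · have hfin : {i : ℕ | ∃ θ ∈ Γ, (ε / Real.sqrt d) ^ 2 ≤ θ i ^ 2}.Finite := by
      by_contra hinf
      obtain ⟨A, hA, hAcard⟩ := Set.Infinite.exists_subset_card_eq hinf (d / 2)
      exact hB ⟨A, hAcard, fun i hi => hA hi⟩
    have hcard : hfin.toFinset.card < d / 2 := by
      by_contra! hle
      obtain ⟨A, hA, hAcard⟩ := Finset.exists_subset_card_eq hle
      exact hB ⟨A, hAcard, fun i hi => hfin.mem_toFinset.mp (hA hi)⟩
    obtain ⟨θ, hθ, F, hF, hlt⟩ := exists_finset_lt_sum_of_card_lt_kolDimCoord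
      (show hfin.toFinset.card < kolDimCoord Γ ε by omega)
    obtain ⟨S, -, hdisj, hS⟩ := exists_pairwise_disjoint_le_sum hc (d / 2) F
      (f := fun i => θ i ^ 2)
      (fun i hi => by
        by_contra! hle
        exact Finset.disjoint_left.mp hF hi (hfin.mem_toFinset.mpr ⟨θ, hθ, hle⟩))
      (by
        refine le_trans ?_ hlt.le
        have hhalf : ((d / 2 : ℕ) : ℝ) ≤ d / 2 := Nat.cast_div_le
        calc 2 * (ε / Real.sqrt d) ^ 2 * ((d / 2 : ℕ) : ℝ)
            ≤ 2 * (ε / Real.sqrt d) ^ 2 * (d / 2) := by gcongr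
          _ = ε ^ 2 := by rw [hsq]; field_simp)
    exact horth.exists_orthogonal_of_disjoint hconv (fun _ => θ) (fun _ => hθ) S hdisj hS
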